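/- Suppose k, f, s satisfy (i) k' = k^2 − k·f, (ii) s' = 2·k·s and (iv) k·f = s^2 − c at every point of I, that k(t) ≠ 0 for every t ∈ I, and that 3·s^2 − k^2 − 3·c = 0 at every point of I. Then k^2 = 7·s^2 − c at every point of I. -/

import Mathlib

/-- Differentiating the reduced bitension relation `3·s² − k² − 3·c = 0` along
the flow (using the structure equations (i), (ii), (iv) and `k ≠ 0`) yields
`k² = 7·s² − c`. -/
theorem deriv_bitension_relation
    (a b : ℝ) (hab : a < b) (I : Set ℝ) (hI : I = Set.Ioo a b)
    (k f s : ℝ → ℝ) (hk : ContDiff ℝ (⊤ : ℕ∞) k) (hf : ContDiff ℝ (⊤ : ℕ∞) f)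
    (hs : ContDiff ℝ (⊤ : ℕ∞) s) (c : ℝ)
    (h1 : ∀ t ∈ I, deriv k t = k t ^ 2 - k t * f t)
    (h2 : ∀ t ∈ I, deriv s t = 2 * k t * s t)
    (h4 : ∀ t ∈ I, k t * f t = s t ^ 2 - c)
    (hk0 : ∀ t ∈ I, k t ≠ 0)
    (hbi : ∀ t ∈ I, 3 * s t ^ 2 - k t ^ 2 - 3 * c = 0) :
    ∀ t ∈ I, k t ^ 2 = 7 * s t ^ 2 - c := by
  intro t ht
  have hkd : HasDerivAt k (deriv k t) t :=
    (hk.differentiable (by simp) t).hasDerivAt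
  have hsd : HasDerivAt s (deriv s t) t :=
    (hs.differentiable (by simp) t).hasDerivAt
  have hd := (((hsd.pow 2).const_mul 3).sub (hkd.pow 2)).sub_const (3 * c)
  have hI_nhds : I ∈ nhds t := (hI ▸ isOpen_Ioo : IsOpen I).mem_nhds ht
  have hzero : HasDerivAt (fun _ : ℝ => (0 : ℝ)) _ t :=
    hd.congr_of_eventuallyEq <| by
      filter_upwards [hI_nhds] with x hx
      exact (hbi x hx).symm
  have heq := hzero.unique (hasDerivAt_const t 0)
  rw [h1 t ht, h2 t ht, h4 t ht] at heq
  have hmul : k t * (k t ^ 2 - (7 * s t ^ 2 - c)) = 0 := by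
    norm_num at heq
    linear_combination (-1 / 2) * heq
  exact sub_eq_zero.mp ((mul_eq_zero.mp hmul).resolve_left (hk0 t ht))
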